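/- Let B = B_1 ⊕ ⋯ ⊕ B_r be a block diagonal matrix of 3×3 blocks of distinct independent variables (i.e., B is a generic block diagonal matrix over the polynomial ring in 9r variables). If per(B) = Σ_{i=1}^k c_i det(S_i ∘ B) as polynomials, where c_i ∈ ℝ and S_i are 3r×3r sign matrices, then k ≥ (8/3)^r. -/

import Mathlib

open MvPolynomial

/-- The permanent of a square matrix. -/
def Matrix.per {m : Type*} [Fintype m] [DecidableEq m] {R : Type*} [CommRing R]
    (A : Matrix m m R) : R :=
  ∑ σ : Equiv.Perm m, ∏ i, A i (σ i)

/-- The generic block diagonal matrix with `r` blocks of size `3 × 3` whose entries are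
distinct indeterminates. -/
noncomputable def genericBlockDiag3 (r : ℕ) :
    Matrix (Fin (3 * r)) (Fin (3 * r)) (MvPolynomial (Fin r × Fin 3 × Fin 3) ℝ) := fun i j =>
  if (i : ℕ) / 3 = (j : ℕ) / 3 then
    X (⟨(i : ℕ) / 3, by have := i.isLt; omega⟩,
       ⟨(i : ℕ) % 3, by omega⟩, ⟨(j : ℕ) % 3, by omega⟩)
  else 0

namespace BlockAmp

abbrev Sg := Fin 3 → Fin 3 → ℤˣ

/-- Index equivalence. -/
def e (r : ℕ) : Fin (3 * r) ≃ Fin 3 × Fin r where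
  toFun i := (⟨(i : ℕ) % 3, by omega⟩, ⟨(i : ℕ) / 3, by have := i.isLt; omega⟩)
  invFun p := ⟨3 * p.2 + p.1, by have := p.1.isLt; have := p.2.isLt; omega⟩
  left_inv i := by ext; simp; omega
  right_inv p := by
    have := p.1.isLt
    ext <;> simp <;> omega

def detf (A : Sg) : ℤ :=
  A 0 0 * A 1 1 * A 2 2 - A 0 0 * A 1 2 * A 2 1 - A 0 1 * A 1 0 * A 2 2
    + A 0 1 * A 1 2 * A 2 0 + A 0 2 * A 1 0 * A 2 1 - A 0 2 * A 1 1 * A 2 0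

def perf (A : Sg) : ℤ :=
  A 0 0 * A 1 1 * A 2 2 + A 0 0 * A 1 2 * A 2 1 + A 0 1 * A 1 0 * A 2 2
    + A 0 1 * A 1 2 * A 2 0 + A 0 2 * A 1 0 * A 2 1 + A 0 2 * A 1 1 * A 2 0

set_option maxRecDepth 100000 in
lemma card_good : (Finset.univ.filter fun A : Sg => detf A ≠ 0).card = 192 := by
  decide +kernel

set_option maxRecDepth 100000 in
lemma perf_ne : ∀ A : Sg, perf A ≠ 0 := by
  decide +kernel

lemma per_three (A : Sg) : Matrix.per (Matrix.of fun i j => ((A i j : ℤ) : ℝ)) = (perf A : ℝ) := by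
  have hu : (Finset.univ : Finset (Equiv.Perm (Fin 3))) =
    {1, Equiv.swap 1 2, Equiv.swap 0 1, Equiv.swap 0 1 * Equiv.swap 1 2,
      Equiv.swap 1 2 * Equiv.swap 0 1, Equiv.swap 0 2} := by decide
  have h1 : (Equiv.swap (1 : Fin 3) 2) 0 = 0 := by decide
  have h2 : (Equiv.swap (0 : Fin 3) 1) 2 = 2 := by decide
  have h3 : (Equiv.swap (0 : Fin 3) 2) 1 = 1 := by decide
  rw [Matrix.per, hu]
  repeat rw [Finset.sum_insert (by decide)]
  rw [Finset.sum_singleton]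
  simp [Fin.prod_univ_three, perf, h1, h2, h3]
  ring

lemma det_three (A : Sg) : (Matrix.of fun i j => ((A i j : ℤ) : ℝ)).det = (detf A : ℝ) := by
  rw [Matrix.det_fin_three]; simp [detf]

lemma card_sg : Fintype.card Sg = 512 := by
  simp [Sg]

lemma card_good_le (r : ℕ) (T : Fin r → Sg) :
    (Finset.univ.filter fun A : Fin r → Sg => ∀ b, detf (T b * A b) ≠ 0).card ≤ 192 ^ r := by
  have : (Fintype.piFinset fun _ : Fin r =>
      (Finset.univ.filter fun A : Sg => detf A ≠ 0)).card = 192 ^ r := by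
    rw [Fintype.card_piFinset]; simp [card_good]
  rw [← this]
  apply Finset.card_le_card_of_injOn (fun A => T * A)
  · intro A hA
    simpa [Fintype.mem_piFinset] using hA
  · intro A _ B _ h
    exact mul_left_cancel h

lemma per_submatrix {m n R : Type*} [Fintype m] [DecidableEq m] [Fintype n] [DecidableEq n]
    [CommRing R] (f : m ≃ n) (A : Matrix n n R) : (A.submatrix f f).per = A.per := by
  unfold Matrix.per
  refine Fintype.sum_equiv (Equiv.permCongr f) _ _ fun σ => ?_
  exact Fintype.prod_equiv f _ _ fun i => by simp

lemma per_blockDiagonal {n o R : Type*} [Fintype n] [DecidableEq n] [Fintype o] [DecidableEq o]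
    [CommRing R] (M : o → Matrix n n R) :
    (Matrix.blockDiagonal M).per = ∏ k, (M k).per := by
  unfold Matrix.per
  rw [Finset.prod_univ_sum, Fintype.piFinset_univ]
  symm
  refine Finset.sum_of_injOn (fun σ => Equiv.prodCongrLeft σ) ?_ ?_ ?_ ?_
  · intro σ _ σ' _ h
    funext k
    ext x
    have := congrArg (fun τ : Equiv.Perm (n × o) => (τ (x, k)).1) h
    simpa using this
  · intro σ _
    simp
  · intro σ _ hσ
    by_contra hne
    apply hσ
    have hp : ∀ x, (σ x).2 = x.2 := by
      intro x
      by_contra hx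
      apply hne
      refine Finset.prod_eq_zero (Finset.mem_univ x) ?_
      rw [Matrix.blockDiagonal_apply, if_neg]
      exact fun h => hx h.symm
    have hq : ∀ x, (σ.symm x).2 = x.2 := fun x => by
      simpa [eq_comm] using hp (σ.symm x)
    have h1 : ∀ k x, ((σ (x, k)).1, k) = σ (x, k) := fun k x => Prod.ext rfl (hp (x, k)).symm
    have h2 : ∀ k x, ((σ.symm (x, k)).1, k) = σ.symm (x, k) :=
      fun k x => Prod.ext rfl (hq (x, k)).symm
    refine ⟨fun k => ⟨fun x => (σ (x, k)).1, fun x => (σ.symm (x, k)).1, ?_, ?_⟩, by simp, ?_⟩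
    · intro x
      simp [h1]
    · intro x
      simp [h2]
    · apply Equiv.ext
      rintro ⟨x, k⟩
      simp [h1]
  · intro σ _
    rw [Fintype.prod_prod_type_right]
    simp

lemma map_per {m R R' : Type*} [Fintype m] [DecidableEq m] [CommRing R] [CommRing R']
    (f : R →+* R') (A : Matrix m m R) : f A.per = (A.map f).per := by
  simp [Matrix.per]

/-- The substitution. -/
noncomputable def pt {r : ℕ} (A : Fin r → Sg) : Fin r × Fin 3 × Fin 3 → ℝ :=
  fun x => ((A x.1 x.2.1 x.2.2 : ℤ) : ℝ)

lemma eval_gen {r : ℕ} (A : Fin r → Sg) (u v : Fin (3 * r)) :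
    eval (pt A) (genericBlockDiag3 r u v) =
      if (e r u).2 = (e r v).2 then ((A (e r u).2 (e r u).1 (e r v).1 : ℤ) : ℝ) else 0 := by
  unfold genericBlockDiag3
  have : (e r u).2 = (e r v).2 ↔ (u : ℕ) / 3 = (v : ℕ) / 3 := by simp [e]
  simp only [this]
  split_ifs <;> simp [pt, e]

lemma eval_per {r : ℕ} (A : Fin r → Sg) :
    eval (pt A) (genericBlockDiag3 r).per ≠ 0 := by
  have : (genericBlockDiag3 r).map (eval (pt A)) =
      (Matrix.blockDiagonal fun b => Matrix.of fun i j => ((A b i j : ℤ) : ℝ)).submatrix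
        (e r) (e r) := by
    ext u v
    simp [eval_gen, Matrix.blockDiagonal_apply]
  rw [map_per, this, per_submatrix, per_blockDiagonal, Finset.prod_ne_zero_iff]
  intro b _
  rw [per_three]
  exact_mod_cast perf_ne _

lemma eval_det {r : ℕ} (A : Fin r → Sg) (s : Fin (3 * r) → Fin (3 * r) → ℤˣ)
    (S : Matrix (Fin (3 * r)) (Fin (3 * r)) ℝ) (hs : ∀ u v, S u v = ((s u v : ℤ) : ℝ)) :
    eval (pt A) (Matrix.of fun u v => C (S u v) * genericBlockDiag3 r u v).det =
      ∏ b, (detf ((fun i j => s ((e r).symm (i, b)) ((e r).symm (j, b))) * A b) : ℝ) := by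
  have : (Matrix.of fun u v => C (S u v) * genericBlockDiag3 r u v).map (eval (pt A)) =
      (Matrix.blockDiagonal fun b => Matrix.of fun i j =>
        ((((fun i j => s ((e r).symm (i, b)) ((e r).symm (j, b))) * A b : Sg) i j : ℤ) : ℝ)).submatrix
        (e r) (e r) := by
    ext u v
    by_cases h : (e r u).2 = (e r v).2
    · have hv : ((e r v).1, (e r u).2) = e r v := by rw [h]
      simp [eval_gen, Matrix.blockDiagonal_apply, h, hs]
      rw [← h]
      simp
    · simp [eval_gen, Matrix.blockDiagonal_apply, h]
  rw [RingHom.map_det, RingHom.mapMatrix_apply, this, Matrix.det_submatrix_equiv_self,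
    Matrix.det_blockDiagonal]
  exact Finset.prod_congr rfl fun b _ => det_three _

end BlockAmp

open BlockAmp in
theorem block_amplification_polynomial (r k : ℕ) (hr : 1 ≤ r)
    (c : Fin k → ℝ) (S : Fin k → Matrix (Fin (3 * r)) (Fin (3 * r)) ℝ)
    (hS : ∀ i, ∀ u v, S i u v = 1 ∨ S i u v = -1)
    (h : Matrix.per (genericBlockDiag3 r) =
      ∑ i, C (c i) *
        (Matrix.of fun u v => C (S i u v) * genericBlockDiag3 r u v).det) :
    ((8 : ℝ) / 3) ^ r ≤ (k : ℝ) := by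
  have hs : ∀ i u v, ∃ s : ℤˣ, S i u v = ((s : ℤ) : ℝ) := by
    intro i u v
    rcases hS i u v with h | h
    · exact ⟨1, by simp [h]⟩
    · exact ⟨-1, by simp [h]⟩
  choose s hs using hs
  let T : Fin k → Fin r → Sg := fun l b i j => s l ((e r).symm (i, b)) ((e r).symm (j, b))
  have hcov : (Finset.univ : Finset (Fin r → Sg)) ⊆ Finset.univ.biUnion fun l : Fin k =>
      (Finset.univ.filter fun A : Fin r → Sg => ∀ b, detf (T l b * A b) ≠ 0) := by
    intro A _
    have h1 := eval_per A
    rw [h, map_sum] at h1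
    obtain ⟨l, _, hl⟩ := Finset.exists_ne_zero_of_sum_ne_zero h1
    rw [map_mul, eval_det A (s l) (S l) (hs l)] at hl
    have h2 := Finset.prod_ne_zero_iff.1 (right_ne_zero_of_mul hl)
    simp only [Finset.mem_biUnion, Finset.mem_univ, true_and, Finset.mem_filter]
    exact ⟨l, fun b => by exact_mod_cast h2 b (Finset.mem_univ _)⟩
  have h3 : 512 ^ r ≤ k * 192 ^ r := by
    have := (Finset.card_le_card hcov).trans (Finset.card_biUnion_le_card_mul _ _ (192 ^ r)
      fun l _ => card_good_le r (T l))
    rw [Finset.card_univ, Fintype.card_fun, card_sg] at this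
    simpa using this
  have h4 : (512 : ℝ) ^ r ≤ k * 192 ^ r := by exact_mod_cast h3
  have h5 : ((8 : ℝ) / 3) = 512 / 192 := by norm_num
  rw [h5, div_pow, div_le_iff₀ (by positivity)]
  exact h4
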